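/- For all n ≥ 5 and p ≥ 0, A(C_n ∪ pK_1) > A(C_{n−2} ∪ (p+2)K_1). -/

import Mathlib

open Finset SimpleGraph

/-- A coloring partition of `G`: a partition of the vertex set into (nonempty)
independent (stable) sets. -/
def IsStablePartition {V : Type*} [Fintype V] [DecidableEq V] (G : SimpleGraph V)
    (P : Finpartition (univ : Finset V)) : Prop :=
  ∀ t ∈ P.parts, ∀ u ∈ t, ∀ v ∈ t, ¬ G.Adj u v

open scoped Classical in
/-- `colB G` : the number of coloring partitions of `G`. -/
noncomputable def colB {V : Type*} [Fintype V] [DecidableEq V] (G : SimpleGraph V) : ℕ :=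
  (univ.filter (IsStablePartition G)).card

open scoped Classical in
/-- `colT G` : the total number of blocks summed over all coloring partitions of `G`. -/
noncomputable def colT {V : Type*} [Fintype V] [DecidableEq V] (G : SimpleGraph V) : ℕ :=
  ∑ P ∈ univ.filter (IsStablePartition G), P.parts.card

/-- `colA G = colT G / colB G` : the average number of blocks. -/
noncomputable def colA {V : Type*} [Fintype V] [DecidableEq V] (G : SimpleGraph V) : ℚ :=
  (colT G : ℚ) / (colB G : ℚ)

/-- The `n`-th Bell number: the number of partitions of an `n`-element set. -/
noncomputable def bell (n : ℕ) : ℕ :=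
  Fintype.card (Finpartition (univ : Finset (Fin n)))

/-- The disjoint union of `G` with `p` isolated vertices (`G ∪ pK₁`). -/
def unionIsolated {V : Type*} (G : SimpleGraph V) (p : ℕ) : SimpleGraph (V ⊕ Fin p) :=
  SimpleGraph.fromRel (fun x y => ∃ a b, x = Sum.inl a ∧ y = Sum.inl b ∧ G.Adj a b)

/-- `Hgraph n r` : the graph obtained from the disjoint union of the cycle `C_n` and the
path `P_r` by adding an edge between one endpoint of the path (vertex `0`) and one vertex
of the cycle (vertex `0`). -/
def Hgraph (n r : ℕ) : SimpleGraph (Fin n ⊕ Fin r) :=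
  SimpleGraph.fromRel (fun x y =>
    (∃ a b, x = Sum.inl a ∧ y = Sum.inl b ∧ (cycleGraph n).Adj a b) ∨
    (∃ a b, x = Sum.inr a ∧ y = Sum.inr b ∧ (pathGraph r).Adj a b) ∨
    (∃ (a : Fin n) (b : Fin r), a.val = 0 ∧ b.val = 0 ∧ x = Sum.inl a ∧ y = Sum.inr b))


theorem Finpartition.eq_of_part_eq_iff {V : Type*} [Fintype V] [DecidableEq V]
    {P Q : Finpartition (univ : Finset V)}
    (h : ∀ u v, P.part u = P.part v ↔ Q.part u = Q.part v) : P = Q := by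
  have hpart : ∀ a, P.part a = Q.part a := fun a => by
    ext b
    rw [P.mem_part_iff_part_eq_part (mem_univ b) (mem_univ a),
      Q.mem_part_iff_part_eq_part (mem_univ b) (mem_univ a), h]
  ext t
  constructor <;> intro ht
  · obtain ⟨a, ha⟩ := P.nonempty_of_mem_parts ht
    rw [← P.part_eq_of_mem ht ha, hpart]
    exact Q.part_mem.2 (mem_univ a)
  · obtain ⟨a, ha⟩ := Q.nonempty_of_mem_parts ht
    rw [← Q.part_eq_of_mem ht ha, ← hpart]
    exact P.part_mem.2 (mem_univ a)

/-- The number of proper colorings of `G` with colors in `Fin k`. -/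
noncomputable def numColorings {V : Type*} (G : SimpleGraph V) (k : ℕ) : ℕ :=
  Nat.card {c : V → Fin k // ∀ u v, G.Adj u v → c u ≠ c v}

/-- The coloring obtained by giving distinct colors to the blocks of a stable partition. -/
def coloringOfPartition {V : Type*} [Fintype V] [DecidableEq V] (G : SimpleGraph V) (k : ℕ)
    (x : Σ P : {P : Finpartition (univ : Finset V) // IsStablePartition G P},
      (P.1.parts ↪ Fin k)) :
    {c : V → Fin k // ∀ u v, G.Adj u v → c u ≠ c v} :=
  ⟨fun v => x.2 ⟨x.1.1.part v, x.1.1.part_mem.2 (mem_univ v)⟩, fun u v huv h => by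
    have h' := congrArg Subtype.val (x.2.injective h)
    exact x.1.2 _ (x.1.1.part_mem.2 (mem_univ v)) u
      ((x.1.1.mem_part_iff_part_eq_part (mem_univ u) (mem_univ v)).2 h') v
      (x.1.1.mem_part (mem_univ v)) huv⟩

theorem coloringOfPartition_eq_iff {V : Type*} [Fintype V] [DecidableEq V] (G : SimpleGraph V)
    (k : ℕ) (x) (u v : V) :
    (coloringOfPartition G k x).1 u = (coloringOfPartition G k x).1 v ↔
      x.1.1.part u = x.1.1.part v := by
  simp [coloringOfPartition]

theorem coloringOfPartition_bijective {V : Type*} [Fintype V] [DecidableEq V]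
    (G : SimpleGraph V) (k : ℕ) : Function.Bijective (coloringOfPartition G k) := by
  classical
  constructor
  · intro x y hxy
    have hPQ : x.1 = y.1 := Subtype.ext <| Finpartition.eq_of_part_eq_iff fun u v => by
      rw [← coloringOfPartition_eq_iff, hxy, coloringOfPartition_eq_iff]
    obtain ⟨P, e⟩ := x
    obtain ⟨Q, e'⟩ := y
    obtain rfl : P = Q := hPQ
    congr 1
    ext ⟨t, ht⟩
    obtain ⟨a, ha⟩ := P.1.nonempty_of_mem_parts ht
    have := congrFun (congrArg Subtype.val hxy) a
    simp only [coloringOfPartition, P.1.part_eq_of_mem ht ha] at this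
    rw [this]
  · rintro ⟨c, hc⟩
    let P := Finpartition.ofSetoid (Setoid.ker c)
    have hP : ∀ u v, u ∈ P.part v ↔ c v = c u := fun u v =>
      Finpartition.mem_part_ofSetoid_iff_rel
    have hmem : ∀ t ∈ P.parts, ∀ u ∈ t, ∀ v ∈ t, c u = c v := fun t ht u hu v hv => by
      rw [← P.part_eq_of_mem ht hu, hP] at hv
      exact hv
    choose r hr using fun t : P.parts => P.nonempty_of_mem_parts t.2
    refine ⟨⟨⟨P, fun t ht u hu v hv huv => hc u v huv (hmem t ht u hu v hv)⟩,
      ⟨fun t => c (r t), fun s t hst => ?_⟩⟩, ?_⟩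
    · have h : r t ∈ P.part (r s) := (hP _ _).2 hst
      rw [P.part_eq_of_mem s.2 (hr s)] at h
      exact Subtype.ext (P.eq_of_mem_parts s.2 t.2 h (hr t))
    · refine Subtype.ext (funext fun v => ?_)
      exact hmem (P.part v) (P.part_mem.2 (mem_univ v)) _ (hr ⟨P.part v, _⟩) v
        (P.mem_part (mem_univ v))

open scoped Classical in
theorem numColorings_eq_sum_descFactorial {V : Type*} [Fintype V] [DecidableEq V]
    (G : SimpleGraph V) (k : ℕ) :
    numColorings G k =
      ∑ P ∈ univ.filter (IsStablePartition G), k.descFactorial P.parts.card := by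
  rw [numColorings, ← Nat.card_eq_of_bijective _ (coloringOfPartition_bijective G k),
    Nat.card_sigma]
  simp only [Nat.card_eq_fintype_card, Fintype.card_embedding_eq, Fintype.card_fin,
    Fintype.card_coe]
  exact (sum_subtype (univ.filter (IsStablePartition G)) (by simp)
    (fun P : Finpartition (univ : Finset V) => k.descFactorial P.parts.card)).symm

theorem hasSum_descFactorial_div_factorial (j : ℕ) :
    HasSum (fun k : ℕ => (k.descFactorial j : ℝ) / k.factorial) (Real.exp 1) := by
  have hexp : HasSum (fun k : ℕ => (1 : ℝ) / k.factorial) (Real.exp 1) := by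
    simpa [Real.exp_eq_exp_ℝ] using NormedSpace.expSeries_div_hasSum_exp (1 : ℝ)
  rw [← (add_left_injective j).hasSum_iff (fun k hk => ?_)]
  · refine hexp.congr_fun fun k => ?_
    have h := Nat.factorial_mul_descFactorial (Nat.le_add_left j k)
    rw [Nat.add_sub_cancel] at h
    simp only [Function.comp_apply]
    rw [← h]
    have h1 : (k.factorial : ℝ) ≠ 0 := by positivity
    have h2 : ((k + j).descFactorial j : ℝ) ≠ 0 := by
      have := Nat.pos_of_ne_zero (mt Nat.descFactorial_eq_zero_iff_lt.1 (by omega : ¬ k + j < j))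
      positivity
    push_cast
    field_simp
  · have : k < j := by
      by_contra! h
      exact hk ⟨k - j, by simp; omega⟩
    simp [Nat.descFactorial_eq_zero_iff_lt.2 this]

theorem hasSum_sub_one_mul_descFactorial_div_factorial (j : ℕ) :
    HasSum (fun k : ℕ => ((k : ℝ) - 1) * ((k.descFactorial j : ℝ) / k.factorial))
      (j * Real.exp 1) := by
  have h := (hasSum_descFactorial_div_factorial (j + 1)).add
    ((hasSum_descFactorial_div_factorial j).mul_left ((j : ℝ) - 1))
  rw [show Real.exp 1 + ((j : ℝ) - 1) * Real.exp 1 = j * Real.exp 1 by ring] at h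
  refine h.congr_fun fun k => ?_
  rw [Nat.descFactorial_succ]
  rcases le_or_gt j k with hjk | hjk
  · push_cast [hjk]
    ring
  · simp [Nat.descFactorial_eq_zero_iff_lt.2 hjk]

theorem hasSum_colB {V : Type*} [Fintype V] [DecidableEq V] (G : SimpleGraph V) :
    HasSum (fun k : ℕ => (numColorings G k : ℝ) / k.factorial) (colB G * Real.exp 1) := by
  classical
  have h := hasSum_sum (s := univ.filter (IsStablePartition G))
    fun P _ => hasSum_descFactorial_div_factorial P.parts.card
  rw [sum_const, nsmul_eq_mul] at h
  convert h using 2 with k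
  · rw [numColorings_eq_sum_descFactorial, Nat.cast_sum, sum_div]
  · rfl

theorem hasSum_colT {V : Type*} [Fintype V] [DecidableEq V] (G : SimpleGraph V) :
    HasSum (fun k : ℕ => ((k : ℝ) - 1) * ((numColorings G k : ℝ) / k.factorial))
      (colT G * Real.exp 1) := by
  classical
  have h := hasSum_sum (s := univ.filter (IsStablePartition G))
    fun P _ => hasSum_sub_one_mul_descFactorial_div_factorial P.parts.card
  rw [← sum_mul, ← Nat.cast_sum] at h
  convert h using 2 with k
  · rw [numColorings_eq_sum_descFactorial, Nat.cast_sum, sum_div, mul_sum]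
  · rfl

theorem numColorings_unionIsolated {V : Type*} (G : SimpleGraph V) (p k : ℕ) :
    numColorings (unionIsolated G p) k = numColorings G k * k ^ p := by
  have e : {c : V ⊕ Fin p → Fin k // ∀ u v, (unionIsolated G p).Adj u v → c u ≠ c v} ≃
      {c : V → Fin k // ∀ u v, G.Adj u v → c u ≠ c v} × (Fin p → Fin k) :=
    { toFun := fun c => ⟨⟨fun v => c.1 (Sum.inl v), fun u v huv => c.2 _ _ <| by
          simp [unionIsolated, huv, huv.ne]⟩, fun i => c.1 (Sum.inr i)⟩
      invFun := fun x => ⟨Sum.elim x.1.1 x.2, by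
        rintro u v ⟨-, ⟨a, b, rfl, rfl, h⟩ | ⟨a, b, rfl, rfl, h⟩⟩
        · exact x.1.2 a b h
        · exact (x.1.2 a b h).symm⟩
      left_inv := fun c => Subtype.ext (by ext (v | v) <;> rfl)
      right_inv := fun x => rfl }
  rw [numColorings, Nat.card_congr e, Nat.card_prod, numColorings]
  simp

/-- Consecutive entries of the tuple `f` are distinct. -/
def IsPathColoring {m k : ℕ} (f : Fin (m + 1) → Fin k) : Prop :=
  ∀ i : Fin m, f i.castSucc ≠ f i.succ

theorem isPathColoring_cons {m k : ℕ} (a : Fin k) (f : Fin (m + 1) → Fin k) :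
    IsPathColoring (Fin.cons a f : Fin (m + 2) → Fin k) ↔ a ≠ f 0 ∧ IsPathColoring f := by
  unfold IsPathColoring
  rw [Fin.forall_fin_succ]
  simp

theorem sum_fin_tuple_succ {m k : ℕ} (F : (Fin (m + 2) → Fin k) → ℤ) :
    ∑ f, F f = ∑ f : Fin (m + 1) → Fin k, ∑ a, F (Fin.cons a f) := by
  rw [sum_comm, ← Fintype.sum_prod_type']
  exact ((Fin.consEquiv fun _ : Fin (m + 2) => Fin k).sum_comp F).symm

open scoped Classical in
theorem sum_isPathColoring (m k : ℕ) :
    ∑ f : Fin (m + 1) → Fin k, (if IsPathColoring f then (1 : ℤ) else 0) =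
      k * ((k : ℤ) - 1) ^ m := by
  induction m with
  | zero => simp [IsPathColoring]
  | succ m ih =>
    rw [sum_fin_tuple_succ, pow_succ, ← mul_assoc, ← ih, sum_mul]
    refine sum_congr rfl fun f _ => ?_
    simp only [isPathColoring_cons, ite_and]
    split_ifs
    · simp [sum_ite, filter_ne', Nat.cast_sub (Fin.pos (f 0))]
    · simp

open scoped Classical in
theorem sum_isPathColoring_ends_ne (m k : ℕ) :
    ∑ f : Fin (m + 1) → Fin k,
        (if IsPathColoring f ∧ f (Fin.last m) ≠ f 0 then (1 : ℤ) else 0) =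
      ((k : ℤ) - 1) ^ (m + 1) + (-1) ^ (m + 1) * ((k : ℤ) - 1) := by
  induction m with
  | zero => simp
  | succ m ih =>
    have hsplit : ∑ f : Fin (m + 2) → Fin k,
        (if IsPathColoring f ∧ f (Fin.last (m + 1)) ≠ f 0 then (1 : ℤ) else 0) +
        ∑ f : Fin (m + 2) → Fin k,
        (if IsPathColoring f ∧ f (Fin.last (m + 1)) = f 0 then (1 : ℤ) else 0) =
        k * ((k : ℤ) - 1) ^ (m + 1) := by
      rw [← sum_isPathColoring, ← sum_add_distrib]
      refine sum_congr rfl fun f _ => ?_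
      by_cases h : IsPathColoring f <;> by_cases h' : f (Fin.last (m + 1)) = f 0 <;> simp [h, h']
    have hclosed : ∑ f : Fin (m + 2) → Fin k,
        (if IsPathColoring f ∧ f (Fin.last (m + 1)) = f 0 then (1 : ℤ) else 0) =
        ∑ f : Fin (m + 1) → Fin k,
        (if IsPathColoring f ∧ f (Fin.last m) ≠ f 0 then (1 : ℤ) else 0) := by
      rw [sum_fin_tuple_succ]
      refine sum_congr rfl fun f _ => ?_
      rw [sum_eq_single (f (Fin.last m))]
      · simp [isPathColoring_cons, ← Fin.succ_last, and_comm]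
      · intro a _ ha
        simp [← Fin.succ_last, ha.symm]
      · simp
    rw [hclosed, ih] at hsplit
    linear_combination hsplit

theorem forall_cycleGraph_adj_iff {m k : ℕ} (c : Fin (m + 2) → Fin k) :
    (∀ u v, (cycleGraph (m + 2)).Adj u v → c u ≠ c v) ↔
      IsPathColoring c ∧ c (Fin.last (m + 1)) ≠ c 0 := by
  have hstep : (∀ u v, (cycleGraph (m + 2)).Adj u v → c u ≠ c v) ↔ ∀ i, c i ≠ c (i + 1) := by
    constructor
    · intro h i
      exact h _ _ (by simp [cycleGraph_adj])
    · rintro h u v (huv | huv)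
      · rw [sub_eq_iff_eq_add'.1 huv, add_comm]
        simpa [add_comm] using (h v).symm
      · rw [sub_eq_iff_eq_add'.1 huv]
        exact h u
  rw [hstep, Fin.forall_fin_succ']
  simp [IsPathColoring]

theorem numColorings_cycleGraph (m k : ℕ) :
    (numColorings (cycleGraph (m + 2)) k : ℤ) =
      ((k : ℤ) - 1) ^ (m + 2) + (-1) ^ (m + 2) * ((k : ℤ) - 1) := by
  classical
  rw [← sum_isPathColoring_ends_ne (m + 1) k, numColorings]
  simp only [forall_cycleGraph_adj_iff, Nat.card_eq_fintype_card, Fintype.card_subtype]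
  simp [sum_boole]

theorem colB_pos {V : Type*} [Fintype V] [DecidableEq V] (G : SimpleGraph V) : 0 < colB G := by
  classical
  refine card_pos.2 ⟨⊥, ?_⟩
  simp only [mem_filter, mem_univ, true_and]
  intro t ht u hu v hv
  obtain ⟨a, -, rfl⟩ := Finpartition.mem_bot_iff.1 ht
  rw [mem_singleton.1 hu, mem_singleton.1 hv]
  exact G.loopless.irrefl a

/-- If `f / g` is strictly increasing, then the mean of `f` exceeds the mean of `g`. -/
theorem mean_lt_mean_of_ratio_strictMono {f g : ℕ → ℝ} {Bf Bg Tf Tg : ℝ} (K : ℕ)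
    (hf0 : ∀ k < K, f k = 0) (hg0 : ∀ k < K, g k = 0) (hg : ∀ k, K ≤ k → 0 < g k)
    (hstep : ∀ k, K ≤ k → f k * g (k + 1) < f (k + 1) * g k)
    (hBf : HasSum f Bf) (hBg : HasSum g Bg)
    (hTf : HasSum (fun k : ℕ => ((k : ℝ) - 1) * f k) Tf)
    (hTg : HasSum (fun k : ℕ => ((k : ℝ) - 1) * g k) Tg) :
    Tg * Bf < Tf * Bg := by
  have hratio : StrictMono fun k => f (K + k) / g (K + k) := strictMono_nat_of_lt_succ fun k => by
    rw [div_lt_div_iff₀ (hg _ (by omega)) (hg _ (by omega))]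
    exact hstep (K + k) (by omega)
  have hlt : ∀ i j, K ≤ i → i < j → f i * g j < f j * g i := fun i j hi hij => by
    have h := hratio (show i - K < j - K by omega)
    simp only [show K + (i - K) = i by omega, show K + (j - K) = j by omega] at h
    rwa [div_lt_div_iff₀ (hg i hi) (hg j (by omega))] at h
  have hle : ∀ i j, i < j → f i * g j ≤ f j * g i := fun i j hij => by
    rcases lt_or_ge i K with hi | hi
    · simp [hf0 i hi, hg0 i hi]
    · exact (hlt i j hi hij).le
  have h₁ := hTf.mul hBg (summable_mul_of_summable_norm hTf.summable.norm hBg.summable.norm)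
  have h₂ := hBf.mul hTg (summable_mul_of_summable_norm hBf.summable.norm hTg.summable.norm)
  have h := h₁.sub h₂
  have hsymm := h.add ((Equiv.prodComm ℕ ℕ).hasSum_iff.2 h)
  have hpos := hasSum_lt (f := fun _ => (0 : ℝ)) (i := (K, K + 1)) (fun x => ?_) ?_
    hasSum_zero hsymm
  · linarith
  · obtain ⟨i, j⟩ := x
    simp only [Function.comp_apply, Equiv.prodComm_apply, Prod.swap_prod_mk]
    rcases lt_trichotomy i j with hij | rfl | hij
    · have h' : (i : ℝ) < j := by exact_mod_cast hij
      nlinarith [hle i j hij]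
    · apply le_of_eq; ring
    · have h' : (j : ℝ) < i := by exact_mod_cast hij
      nlinarith [hle j i hij]
  · simp only [Function.comp_apply, Equiv.prodComm_apply, Prod.swap_prod_mk]
    push_cast
    linarith [hlt K (K + 1) le_rfl (Nat.lt_succ_self K)]

theorem colA_lt_colA_of_ratio_strictMono {V W : Type*} [Fintype V] [DecidableEq V] [Fintype W]
    [DecidableEq W] {G : SimpleGraph V} {H : SimpleGraph W} (K : ℕ)
    (hG : ∀ k < K, (numColorings G k : ℝ) / k.factorial = 0)
    (hH : ∀ k < K, (numColorings H k : ℝ) / k.factorial = 0)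
    (hpos : ∀ k, K ≤ k → 0 < (numColorings H k : ℝ) / k.factorial)
    (hstep : ∀ k, K ≤ k →
      (numColorings G k : ℝ) / k.factorial * ((numColorings H (k + 1) : ℝ) / (k + 1).factorial) <
      (numColorings G (k + 1) : ℝ) / (k + 1).factorial *
        ((numColorings H k : ℝ) / k.factorial)) :
    colA H < colA G := by
  have key := mean_lt_mean_of_ratio_strictMono K hG hH hpos hstep
    (hasSum_colB G) (hasSum_colB H) (hasSum_colT G) (hasSum_colT H)
  have hBG := colB_pos G
  have hBH := colB_pos H
  rw [colA, colA, div_lt_div_iff₀ (by exact_mod_cast hBH) (by exact_mod_cast hBG)]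
  rw [mul_mul_mul_comm, mul_mul_mul_comm (colT G : ℝ)] at key
  exact_mod_cast lt_of_mul_lt_mul_right key (by positivity)

theorem ratio_step_of_neg {t : ℝ} (ht : 2 ≤ t) {m : ℕ} (hm : 2 ≤ m) :
    (t ^ (m + 2) - 1) * ((t + 1) ^ m - 1) * (t + 2) ^ 2 <
      ((t + 1) ^ (m + 2) - 1) * (t ^ m - 1) * (t + 1) ^ 2 := by
  obtain ⟨A, hA⟩ : ∃ A, t ^ m = A + 1 := ⟨t ^ m - 1, by ring⟩
  obtain ⟨B, hB⟩ : ∃ B, (t + 1) ^ m = B + 1 := ⟨(t + 1) ^ m - 1, by ring⟩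
  have h₁ : t ^ 2 ≤ t ^ m := pow_le_pow_right₀ (by linarith) hm
  have h₂ : (t + 1) ^ 2 ≤ (t + 1) ^ m := pow_le_pow_right₀ (by linarith) hm
  have hA' : t ^ 2 - 1 ≤ A := by linarith
  have ht1 : 0 < t ^ 2 - 1 := by nlinarith
  have hA0 : 0 < A := by linarith
  have hB0 : 0 < B := by nlinarith
  rw [pow_add, pow_add, hA, hB]
  have h₃ : 0 < B * (t ^ 2 - 1) * (t ^ 2 - 3) := by
    have : 0 < t ^ 2 - 3 := by nlinarith
    positivity
  have h₄ : 0 ≤ B * (A - (t ^ 2 - 1)) * (2 * t ^ 2 + 4 * t + 1) :=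
    mul_nonneg (mul_nonneg hB0.le (by linarith)) (by positivity)
  have h₅ : 0 ≤ A * (t * (t + 2)) * (t + 1) ^ 2 := by positivity
  linear_combination h₃ + h₄ + h₅

theorem ratio_step_of_pos {t : ℝ} (ht : 1 ≤ t) {m : ℕ} (hm : 3 ≤ m) :
    (t ^ (m + 2) + 1) * ((t + 1) ^ m + 1) * (t + 2) ^ 2 <
      ((t + 1) ^ (m + 2) + 1) * (t ^ m + 1) * (t + 1) ^ 2 := by
  obtain ⟨A, hA⟩ : ∃ A, t ^ m = A - 1 := ⟨t ^ m + 1, by ring⟩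
  obtain ⟨B, hB⟩ : ∃ B, (t + 1) ^ m = B - 1 := ⟨(t + 1) ^ m + 1, by ring⟩
  have h₂ : (t + 1) ^ 3 ≤ (t + 1) ^ m := pow_le_pow_right₀ (by linarith) hm
  have hA0 : 0 < A := by
    have : 0 < t ^ m := by positivity
    linarith
  have hB' : (t + 2) * (t ^ 2 + t + 1) ≤ B := by linarith
  have hB0 : 0 < B := lt_of_lt_of_le (by positivity) hB'
  rw [pow_add, pow_add, hA, hB]
  have h₃ : 0 < A * (t + 2) * (2 * t ^ 4 + 5 * t ^ 3 + 5 * t ^ 2 + 4 * t + 1) := by positivity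
  have h₄ : 0 ≤ A * (B - (t + 2) * (t ^ 2 + t + 1)) * (2 * t ^ 2 + 4 * t + 1) :=
    mul_nonneg (mul_nonneg hA0.le (by linarith)) (by positivity)
  have h₅ : 0 ≤ (t ^ 2 - 1) * (t + 2) ^ 2 * B :=
    mul_nonneg (mul_nonneg (by nlinarith) (by positivity)) hB0.le
  linear_combination h₃ + h₄ + h₅

/-- The number of proper colorings of `C_{m + 2} ∪ pK₁` with `t + 1` colors. -/
theorem numColorings_unionIsolated_cycleGraph (m p t : ℕ) :
    (numColorings (unionIsolated (cycleGraph (m + 2)) p) (t + 1) : ℝ) =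
      t * ((t : ℝ) ^ (m + 1) + (-1) ^ m) * ((t : ℝ) + 1) ^ p := by
  have h : (numColorings (cycleGraph (m + 2)) (t + 1) : ℝ) = _ :=
    congrArg (Int.cast : ℤ → ℝ) (numColorings_cycleGraph m (t + 1))
  rw [numColorings_unionIsolated, Nat.cast_mul, h]
  push_cast
  ring

theorem numColorings_unionIsolated_cycleGraph_zero (m p : ℕ) :
    numColorings (unionIsolated (cycleGraph (m + 2)) p) 0 = 0 := by
  have h := numColorings_cycleGraph m 0
  rw [numColorings_unionIsolated, show numColorings (cycleGraph (m + 2)) 0 = 0 from ?_, zero_mul]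
  have : (numColorings (cycleGraph (m + 2)) 0 : ℤ) = 0 := by
    rw [h]
    push_cast
    ring
  exact_mod_cast this

/-- For all `n ≥ 5` and `p ≥ 0`, `A(C_n ∪ pK₁) > A(C_{n-2} ∪ (p+2)K₁)`. -/
theorem stmt_19 (n p : ℕ) (hn : 5 ≤ n) :
    colA (unionIsolated (cycleGraph n) p) >
      colA (unionIsolated (cycleGraph (n - 2)) (p + 2)) := by
  obtain ⟨m, rfl⟩ : ∃ m, n = m + 2 + 2 := ⟨n - 4, by omega⟩
  rw [Nat.add_sub_cancel]
  obtain ⟨K, hK1, hzero, hpos, hstep⟩ : ∃ K : ℕ, 1 ≤ K ∧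
      (∀ t : ℕ, t < K → t = 0 ∨ t = 1 ∧ (-1 : ℝ) ^ m = -1) ∧
      (∀ t : ℕ, K ≤ t → 0 < (t : ℝ) ^ (m + 1) + (-1) ^ m) ∧
      (∀ t : ℕ, K ≤ t →
        ((t : ℝ) ^ (m + 3) + (-1) ^ m) * (((t : ℝ) + 1) ^ (m + 1) + (-1) ^ m) * (t + 2) ^ 2 <
        (((t : ℝ) + 1) ^ (m + 3) + (-1) ^ m) * ((t : ℝ) ^ (m + 1) + (-1) ^ m) * (t + 1) ^ 2) := by
    rcases Nat.even_or_odd m with hm | hm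
    · refine ⟨1, le_rfl, fun t ht => Or.inl (by omega), fun t ht => ?_, fun t ht => ?_⟩
      · rw [hm.neg_one_pow]
        positivity
      · rw [hm.neg_one_pow]
        obtain ⟨j, rfl⟩ := hm
        exact ratio_step_of_pos (m := j + j + 1) (by exact_mod_cast ht) (by omega)
    · refine ⟨2, by norm_num, fun t ht => ?_, fun t ht => ?_, fun t ht => ?_⟩
      · rw [hm.neg_one_pow]
        simp only [and_true]
        omega
      · rw [hm.neg_one_pow]
        have : (1 : ℝ) < (t : ℝ) ^ (m + 1) := one_lt_pow₀ (by exact_mod_cast ht) (by omega)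
        linarith
      · rw [hm.neg_one_pow]
        exact ratio_step_of_neg (m := m + 1) (by exact_mod_cast ht) (by omega)
  have hvanish : ∀ m' p', (-1 : ℝ) ^ m' = (-1) ^ m → ∀ k < K + 1,
      (numColorings (unionIsolated (cycleGraph (m' + 2)) p') k : ℝ) / k.factorial = 0 := by
    intro m' p' hm' k hk
    rcases k with _ | t
    · simp [numColorings_unionIsolated_cycleGraph_zero]
    · rw [numColorings_unionIsolated_cycleGraph, hm']
      rcases hzero t (by omega) with rfl | ⟨rfl, h⟩
      · simp
      · simp [h]
  refine colA_lt_colA_of_ratio_strictMono (K + 1) (hvanish (m + 2) p (by ring))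
    (hvanish m (p + 2) rfl) ?_ ?_
  · intro k hk
    obtain ⟨t, rfl⟩ : ∃ t, k = t + 1 := ⟨k - 1, by omega⟩
    rw [numColorings_unionIsolated_cycleGraph]
    have := hpos t (by omega)
    have ht : 0 < (t : ℝ) := by exact_mod_cast (by omega : 0 < t)
    positivity
  · intro k hk
    obtain ⟨t, rfl⟩ : ∃ t, k = t + 1 := ⟨k - 1, by omega⟩
    simp only [numColorings_unionIsolated_cycleGraph]
    have ht : 0 < (t : ℝ) := by exact_mod_cast (by omega : 0 < t)
    have hw : 0 < (t : ℝ) * (t + 1) * (((t : ℝ) + 1) ^ p * ((t : ℝ) + 2) ^ p) /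
        (((t + 1).factorial : ℝ) * ((t + 1 + 1).factorial : ℝ)) := by positivity
    have h := mul_lt_mul_of_pos_left (hstep t (by omega)) hw
    generalize ((t + 1).factorial : ℝ) = a at h ⊢
    generalize ((t + 1 + 1).factorial : ℝ) = b at h ⊢
    push_cast
    rw [show (t : ℝ) + 1 + 1 = t + 2 by ring]
    refine lt_of_eq_of_lt ?_ (h.trans_eq ?_) <;> ring
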